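/- Let (A, d^A_m) and (B, d^B_m) be twisted complexes over a commutative ring R. Then the bigraded module A⊗B equipped with the maps ∂_m := d^A_m ⊗ 1 + 1 ⊗ d^B_m (interpreted with the Koszul sign rule) satisfies Σ_{i+j=m} (−1)^i ∂_i ∂_j = 0 for all m ≥ 0, i.e. (A⊗B, ∂_m) is a twisted complex. Moreover, for morphisms of twisted complexes f : A → A' and g : B → B', the family (f⊗g)_m := Σ_{i+j=m} f_i ⊗ g_j is a morphism of twisted complexes A⊗B → A'⊗B', and this assignment is functorial: ((f⊗g)∘(f'⊗g'))_m = ((f∘f')⊗(g∘g'))_m for all m. -/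

import Mathlib

open Finset

noncomputable section

/-- A `(ℤ,ℤ)`-bigraded `R`-module. -/
structure Bigraded (R : Type) [CommRing R] where
  M : ℤ → ℤ → Type
  [acg : ∀ i j, AddCommGroup (M i j)]
  [mod : ∀ i j, Module R (M i j)]

attribute [instance] Bigraded.acg Bigraded.mod

variable {R : Type} [CommRing R]

/-- Transport along equalities of bidegrees. -/
def Bigraded.cast (A : Bigraded R) {i i' j j' : ℤ} (hi : i = i') (hj : j = j') :
    A.M i j →ₗ[R] A.M i' j' := by subst hi; subst hj; exact LinearMap.id

/-- Maps of bigraded modules of bidegree `(p,q)`. -/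
abbrev GMap (A B : Bigraded R) (p q : ℤ) : Type :=
  ∀ i j : ℤ, A.M i j →ₗ[R] B.M (i + p) (j + q)

/-- Change the recorded bidegree of a graded map along equalities of bidegrees. -/
def grecast {A B : Bigraded R} {p q : ℤ} (p' q' : ℤ) (hp : p = p') (hq : q = q')
    (f : GMap A B p q) : GMap A B p' q' :=
  fun i j => (B.cast (by rw [hp]) (by rw [hq])).comp (f i j)

/-- Composition of graded maps: apply `f` first, then `g`. -/
def gcomp {A B C : Bigraded R} {p q p' q' : ℤ} (g : GMap B C p' q') (f : GMap A B p q) :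
    GMap A C (p + p') (q + q') :=
  fun i j => (C.cast (by ring) (by ring)).comp ((g (i + p) (j + q)).comp (f i j))

/-- The identity as a graded map of bidegree `(0,0)`. -/
def idG (A : Bigraded R) : GMap A A 0 0 := fun i j => A.cast (by ring) (by ring)

/-- An element of `wbimod(A,B)_u^v`, i.e. a family of bigraded maps `f_m : A → B` of
bidegree `(u-m, v-m)` for `m ≥ 0`. -/
abbrev WMap (A B : Bigraded R) (u v : ℤ) : Type :=
  ∀ m : ℕ, GMap A B (u - (m : ℤ)) (v - (m : ℤ))

/-- The family of maps `(d_m)` makes `A` into a twisted complex: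
`∑_{i+j=m} (-1)^i d_i d_j = 0` for all `m ≥ 0`. -/
def IsTwDiff (A : Bigraded R) (d : WMap A A 0 1) : Prop :=
  ∀ m : ℕ, ∑ ij ∈ (antidiagonal m).attach,
      ((-1 : ℤ) ^ ij.1.1) •
        grecast (0 - (m : ℤ)) (2 - (m : ℤ))
          (by have := mem_antidiagonal.mp ij.2; omega)
          (by have := mem_antidiagonal.mp ij.2; omega)
          (gcomp (d ij.1.1) (d ij.1.2)) = 0

/-- The family `(f_m)` is a morphism of twisted complexes from `(A, dA)` to `(B, dB)`:
`∑_{i+j=m} d_i^B f_j = ∑_{i+j=m} (-1)^i f_i d_j^A` for all `m ≥ 0`. -/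
def IsTwMor {A B : Bigraded R} (dA : WMap A A 0 1) (dB : WMap B B 0 1)
    (f : WMap A B 0 0) : Prop :=
  ∀ m : ℕ,
    (∑ ij ∈ (antidiagonal m).attach,
      grecast (0 - (m : ℤ)) (1 - (m : ℤ))
        (by have := mem_antidiagonal.mp ij.2; omega)
        (by have := mem_antidiagonal.mp ij.2; omega)
        (gcomp (dB ij.1.1) (f ij.1.2)))
    = ∑ ij ∈ (antidiagonal m).attach,
      ((-1 : ℤ) ^ ij.1.1) •
        grecast (0 - (m : ℤ)) (1 - (m : ℤ))
          (by have := mem_antidiagonal.mp ij.2; omega)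
          (by have := mem_antidiagonal.mp ij.2; omega)
          (gcomp (f ij.1.1) (dA ij.1.2))

/-- A twisted complex (multicomplex) over `R`. -/
structure TwComplex (R : Type) [CommRing R] extends Bigraded R where
  d : WMap toBigraded toBigraded 0 1
  isTw : IsTwDiff toBigraded d

/-- A morphism of twisted complexes. -/
structure TwMorphism (A B : TwComplex R) where
  f : WMap A.toBigraded B.toBigraded 0 0
  isMor : IsTwMor A.d B.d f

/-- Composition of families: `(g ∘ f)_m = ∑_{i+j=m} g_i f_j`. -/
def compFam {A B C : Bigraded R} (g : WMap B C 0 0) (f : WMap A B 0 0) : WMap A C 0 0 :=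
  fun m => ∑ ij ∈ (antidiagonal m).attach,
    grecast (0 - (m : ℤ)) (0 - (m : ℤ))
      (by have := mem_antidiagonal.mp ij.2; omega)
      (by have := mem_antidiagonal.mp ij.2; omega)
      (gcomp (g ij.1.1) (f ij.1.2))

/-- A strict family: concentrated in stage `0`. -/
def strictW {A B : Bigraded R} (g : GMap A B 0 0) : WMap A B 0 0 :=
  fun m => if h : m = 0 then grecast (0 - (m : ℤ)) (0 - (m : ℤ)) (by omega) (by omega) g else 0

/-- The identity family of maps. -/
def idW (A : Bigraded R) : WMap A A 0 0 := strictW (idG A)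

/-! ## Tensor product of bigraded modules and twisted complexes -/

open DirectSum in
/-- Tensor product of bigraded modules: `(A ⊗ B)_i^j = ⊕_{p,q} A_p^q ⊗ B_{i-p}^{j-q}`. -/
def tensorBG (A B : Bigraded R) : Bigraded R where
  M i j := ⨁ pq : ℤ × ℤ, TensorProduct R (A.M pq.1 pq.2) (B.M (i - pq.1) (j - pq.2))
  acg := fun _ _ => inferInstance
  mod := fun _ _ => inferInstance

/-- Koszul tensor product of graded maps:
`(f ⊗ g)(a ⊗ b) = (-1)^{⟨g,a⟩} f(a) ⊗ g(b)` where `⟨x,y⟩ = x₁y₁ + x₂y₂` on bidegrees. -/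
def gtensor {A A' B B' : Bigraded R} {p q p' q' : ℤ}
    (f : GMap A A' p q) (g : GMap B B' p' q') :
    GMap (tensorBG A B) (tensorBG A' B') (p + p') (q + q') :=
  fun i j => DirectSum.toModule R (ℤ × ℤ) ((tensorBG A' B').M (i + (p + p')) (j + (q + q')))
    (fun st =>
      (DirectSum.lof R (ℤ × ℤ)
          (fun pq => TensorProduct R (A'.M pq.1 pq.2)
            (B'.M (i + (p + p') - pq.1) (j + (q + q') - pq.2)))
          (st.1 + p, st.2 + q)).comp
        (((Int.negOnePow (p' * st.1 + q' * st.2) : ℤ) •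
          TensorProduct.map (f st.1 st.2)
            ((B'.cast (by ring) (by ring)).comp (g (i - st.1) (j - st.2))))))

/-- Structure maps of the tensor product of twisted complexes:
`∂_m := d^A_m ⊗ 1 + 1 ⊗ d^B_m` (with the Koszul sign rule). -/
def tensorD {A B : Bigraded R} (dA : WMap A A 0 1) (dB : WMap B B 0 1) :
    WMap (tensorBG A B) (tensorBG A B) 0 1 :=
  fun m => grecast (0 - (m : ℤ)) (1 - (m : ℤ)) (by ring) (by ring) (gtensor (dA m) (idG B))
    + grecast (0 - (m : ℤ)) (1 - (m : ℤ)) (by ring) (by ring) (gtensor (idG A) (dB m))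

/-- Tensor product of morphism families: `(f ⊗ g)_m := ∑_{i+j=m} f_i ⊗ g_j`. -/
def tensorFamW {A A' B B' : Bigraded R} (f : WMap A A' 0 0) (g : WMap B B' 0 0) :
    WMap (tensorBG A B) (tensorBG A' B') 0 0 :=
  fun m => ∑ ij ∈ (antidiagonal m).attach,
    grecast (0 - (m : ℤ)) (0 - (m : ℤ))
      (by have := mem_antidiagonal.mp ij.2; omega)
      (by have := mem_antidiagonal.mp ij.2; omega)
      (gtensor (f ij.1.1) (g ij.1.2))


/-- The total module of a bigraded module. -/
abbrev Bigraded.Tot (A : Bigraded R) : Type :=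
  DirectSum (ℤ × ℤ) fun ij => A.M ij.1 ij.2

/-- The inclusion of a homogeneous component into the total module. -/
def Bigraded.incl (A : Bigraded R) (i j : ℤ) : A.M i j →ₗ[R] A.Tot :=
  DirectSum.lof R (ℤ × ℤ) (fun ij => A.M ij.1 ij.2) (i, j)

theorem Bigraded.incl_injective (A : Bigraded R) (i j : ℤ) :
    Function.Injective (A.incl i j) :=
  DirectSum.of_injective (β := fun ij : ℤ × ℤ => A.M ij.1 ij.2) (i, j)

@[simp]
theorem Bigraded.cast_rfl (A : Bigraded R) {i j : ℤ} (x : A.M i j) : A.cast rfl rfl x = x := rfl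

@[simp]
theorem Bigraded.incl_cast (A : Bigraded R) {i i' j j' : ℤ} (hi : i = i') (hj : j = j')
    (x : A.M i j) : A.incl i' j' (A.cast hi hj x) = A.incl i j x := by
  subst hi hj; rfl

@[simp]
theorem Bigraded.cast_cast (A : Bigraded R) {i i' i'' j j' j'' : ℤ} (hi : i = i') (hj : j = j')
    (hi' : i' = i'') (hj' : j' = j'') (x : A.M i j) :
    A.cast hi' hj' (A.cast hi hj x) = A.cast (hi.trans hi') (hj.trans hj') x := by
  subst hi hj hi' hj'; rfl

theorem gmap_cast {A B : Bigraded R} {p q : ℤ} (f : GMap A B p q) {i i' j j' : ℤ}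
    (hi : i = i') (hj : j = j') (x : A.M i j) :
    f i' j' (A.cast hi hj x) = B.cast (by rw [hi]) (by rw [hj]) (f i j x) := by
  subst hi hj; rfl

/-- The map of total modules induced by a graded map. -/
def tot {A B : Bigraded R} {p q : ℤ} : GMap A B p q →ₗ[R] A.Tot →ₗ[R] B.Tot where
  toFun f := DirectSum.toModule R (ℤ × ℤ) B.Tot
    fun ij => (B.incl (ij.1 + p) (ij.2 + q)).comp (f ij.1 ij.2)
  map_add' f g := by
    ext : 1
    ext x
    simp
  map_smul' r f := by
    ext : 1
    ext x
    simp

@[simp]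
theorem tot_incl {A B : Bigraded R} {p q : ℤ} (f : GMap A B p q) (i j : ℤ) (x : A.M i j) :
    tot f (A.incl i j x) = B.incl (i + p) (j + q) (f i j x) := by
  simp [tot, Bigraded.incl]

theorem tot_ext {A : Bigraded R} {N : Type*} [AddCommGroup N] [Module R N]
    {F G : A.Tot →ₗ[R] N} (h : ∀ i j x, F (A.incl i j x) = G (A.incl i j x)) : F = G := by
  ext ij x
  exact h ij.1 ij.2 x

theorem tot_injective {A B : Bigraded R} {p q : ℤ} :
    Function.Injective (tot : GMap A B p q → A.Tot →ₗ[R] B.Tot) := by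
  intro f g h
  ext i j x
  apply B.incl_injective
  simpa using LinearMap.congr_fun h (A.incl i j x)

@[simp]
theorem tot_grecast {A B : Bigraded R} {p q p' q' : ℤ} (hp : p = p') (hq : q = q')
    (f : GMap A B p q) : tot (grecast p' q' hp hq f) = tot f := by
  subst hp hq; rfl

@[simp]
theorem tot_gcomp {A B C : Bigraded R} {p q p' q' : ℤ} (g : GMap B C p' q')
    (f : GMap A B p q) : tot (gcomp g f) = (tot g).comp (tot f) :=
  tot_ext fun i j x => by simp [gcomp]

@[simp]
theorem tot_idG (A : Bigraded R) : tot (idG A) = LinearMap.id :=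
  tot_ext fun i j x => by simp [idG]

theorem gcomp_idG {A B : Bigraded R} {p q : ℤ} (f : GMap A B p q) :
    gcomp f (idG A) = grecast (0 + p) (0 + q) (zero_add p).symm (zero_add q).symm f :=
  tot_injective (by simp)

theorem idG_gcomp {A B : Bigraded R} {p q : ℤ} (f : GMap A B p q) :
    gcomp (idG B) f = grecast (p + 0) (q + 0) (add_zero p).symm (add_zero q).symm f :=
  tot_injective (by simp)

/-- The bilinear map sending a pair of homogeneous elements to their tensor product in the total
module of `A ⊗ B`. -/
def elemTensor (A B : Bigraded R) (i j s t : ℤ) :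
    A.M s t →ₗ[R] B.M (i - s) (j - t) →ₗ[R] (tensorBG A B).Tot :=
  (TensorProduct.mk R (A.M s t) (B.M (i - s) (j - t))).compr₂
    (((tensorBG A B).incl i j).comp (DirectSum.lof R (ℤ × ℤ)
      (fun pq => TensorProduct R (A.M pq.1 pq.2) (B.M (i - pq.1) (j - pq.2))) (s, t)))

theorem elemTensor_congr (A B : Bigraded R) {i j s t i' j' s' t' : ℤ} (hi : i = i') (hj : j = j')
    (hs : s = s') (ht : t = t') (a : A.M s t) (b : B.M (i - s) (j - t)) :
    elemTensor A B i' j' s' t' (A.cast hs ht a) (B.cast (by rw [hi, hs]) (by rw [hj, ht]) b)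
      = elemTensor A B i j s t a b := by
  subst hi hj hs ht; rfl

theorem tot_tensor_ext {A B : Bigraded R} {N : Type*} [AddCommGroup N] [Module R N]
    {F G : (tensorBG A B).Tot →ₗ[R] N}
    (h : ∀ i j s t a b, F (elemTensor A B i j s t a b) = G (elemTensor A B i j s t a b)) :
    F = G := by
  refine tot_ext fun i j x => ?_
  have : F.comp ((tensorBG A B).incl i j) = G.comp ((tensorBG A B).incl i j) := by
    refine DirectSum.linearMap_ext R fun st => TensorProduct.ext' fun a b => ?_
    exact h i j st.1 st.2 a b
  exact LinearMap.congr_fun this x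

theorem tot_gtensor_elemTensor {A A' B B' : Bigraded R} {p q p' q' : ℤ}
    (f : GMap A A' p q) (g : GMap B B' p' q') (i j s t : ℤ) (a : A.M s t)
    (b : B.M (i - s) (j - t)) :
    tot (gtensor f g) (elemTensor A B i j s t a b)
      = (Int.negOnePow (p' * s + q' * t) : ℤ) •
        elemTensor A' B' (i + (p + p')) (j + (q + q')) (s + p) (t + q) (f s t a)
          (B'.cast (by ring) (by ring) (g (i - s) (j - t) b)) := by
  refine (tot_incl (gtensor f g) i j _).trans ?_
  refine (congrArg _ (DirectSum.toModule_lof R (s, t) _)).trans ?_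
  exact map_zsmul (((tensorBG A' B').incl _ _).comp (DirectSum.lof R (ℤ × ℤ)
    (fun pq => TensorProduct R (A'.M pq.1 pq.2)
      (B'.M (i + (p + p') - pq.1) (j + (q + q') - pq.2))) (s + p, t + q)))
    (Int.negOnePow (p' * s + q' * t) : ℤ)
    (TensorProduct.tmul R (f s t a) (B'.cast (by ring) (by ring) (g (i - s) (j - t) b)))

/-- The Koszul tensor product of graded maps, as a bilinear map into maps of total modules. -/
def totTensor {A A' B B' : Bigraded R} {p q p' q' : ℤ} :
    GMap A A' p q →ₗ[R] GMap B B' p' q' →ₗ[R]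
      (tensorBG A B).Tot →ₗ[R] (tensorBG A' B').Tot :=
  LinearMap.mk₂ R (fun f g => tot (gtensor f g))
    (fun f f' g => tot_tensor_ext fun i j s t a b => by
      simp [tot_gtensor_elemTensor])
    (fun r f g => tot_tensor_ext fun i j s t a b => by
      simpa [tot_gtensor_elemTensor] using smul_comm _ _ _)
    (fun f g g' => tot_tensor_ext fun i j s t a b => by
      simp [tot_gtensor_elemTensor])
    (fun r f g => tot_tensor_ext fun i j s t a b => by
      simpa [tot_gtensor_elemTensor] using smul_comm _ _ _)

theorem tot_gtensor {A A' B B' : Bigraded R} {p q p' q' : ℤ}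
    (f : GMap A A' p q) (g : GMap B B' p' q') : tot (gtensor f g) = totTensor f g := rfl

@[simp]
theorem totTensor_grecast_left {A A' B B' : Bigraded R} {p q p' q' p₁ q₁ : ℤ}
    (hp : p = p₁) (hq : q = q₁) (f : GMap A A' p q) (g : GMap B B' p' q') :
    totTensor (grecast p₁ q₁ hp hq f) g = totTensor f g := by
  subst hp hq; rfl

@[simp]
theorem totTensor_grecast_right {A A' B B' : Bigraded R} {p q p' q' p₁ q₁ : ℤ}
    (hp : p' = p₁) (hq : q' = q₁) (f : GMap A A' p q) (g : GMap B B' p' q') :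
    totTensor f (grecast p₁ q₁ hp hq g) = totTensor f g := by
  subst hp hq; rfl

/-- The interchange law `(f ⊗ g) ∘ (f' ⊗ g') = (-1)^{⟨g,f'⟩} (f ∘ f') ⊗ (g ∘ g')`. -/
theorem totTensor_comp {A A' A'' B B' B'' : Bigraded R} {p q p' q' r s r' s' : ℤ}
    (f : GMap A' A'' p q) (g : GMap B' B'' r s) (f' : GMap A A' p' q') (g' : GMap B B' r' s') :
    (totTensor f g).comp (totTensor f' g')
      = (Int.negOnePow (r * p' + s * q') : ℤ) • totTensor (gcomp f f') (gcomp g g') := by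
  refine tot_tensor_ext fun i j k l a b => ?_
  simp only [← tot_gtensor, LinearMap.comp_apply, LinearMap.smul_apply, tot_gtensor_elemTensor,
    map_zsmul, smul_smul, gcomp, gmap_cast, Bigraded.cast_cast]
  congr 1
  · norm_cast
    simp only [← Int.negOnePow_add]
    congr 1
    ring
  · symm
    refine Eq.trans ?_ (elemTensor_congr A'' B'' (i := i + (p' + r') + (p + r))
      (j := j + (q' + s') + (q + s)) (s := k + p' + p) (t := l + q' + q)
      (i' := i + (p' + p + (r' + r))) (j' := j + (q' + q + (s' + s)))
      (s' := k + (p' + p)) (t' := l + (q' + q))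
      (by ring) (by ring) (by ring) (by ring) _ _)
    simp

theorem totTensor_comp_idG_right {A A' A'' B B' : Bigraded R} {p q p' q' r' s' : ℤ}
    (f : GMap A' A'' p q) (f' : GMap A A' p' q') (g' : GMap B B' r' s') :
    (totTensor f (idG B')).comp (totTensor f' g') = totTensor (gcomp f f') g' := by
  rw [totTensor_comp, idG_gcomp, totTensor_grecast_right]
  simp

theorem totTensor_idG_left_comp {A A' B B' B'' : Bigraded R} {r s p' q' r' s' : ℤ}
    (g : GMap B' B'' r s) (f' : GMap A A' p' q') (g' : GMap B B' r' s') :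
    (totTensor (idG A') g).comp (totTensor f' g')
      = (Int.negOnePow (r * p' + s * q') : ℤ) • totTensor f' (gcomp g g') := by
  rw [totTensor_comp, idG_gcomp, totTensor_grecast_left]

theorem totTensor_comp_totTensor_idG_right {A A' A'' B B' : Bigraded R} {p q r s p' q' : ℤ}
    (f : GMap A' A'' p q) (g : GMap B B' r s) (f' : GMap A A' p' q') :
    (totTensor f g).comp (totTensor f' (idG B))
      = (Int.negOnePow (r * p' + s * q') : ℤ) • totTensor (gcomp f f') g := by
  rw [totTensor_comp, gcomp_idG, totTensor_grecast_right]

theorem totTensor_comp_totTensor_idG_left {A A' B B' B'' : Bigraded R} {p q r s r' s' : ℤ}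
    (f : GMap A A' p q) (g : GMap B' B'' r s) (g' : GMap B B' r' s') :
    (totTensor f g).comp (totTensor (idG A) g') = totTensor f (gcomp g g') := by
  rw [totTensor_comp, gcomp_idG, totTensor_grecast_left]
  simp

theorem linearMap_comp_sum {ι M N P : Type*} [AddCommGroup M] [AddCommGroup N] [AddCommGroup P]
    [Module R M] [Module R N] [Module R P] (g : N →ₗ[R] P) (f : ι → M →ₗ[R] N) (s : Finset ι) :
    g.comp (∑ i ∈ s, f i) = ∑ i ∈ s, g.comp (f i) := by
  ext
  simp

theorem linearMap_sum_comp {ι M N P : Type*} [AddCommGroup M] [AddCommGroup N] [AddCommGroup P]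
    [Module R M] [Module R N] [Module R P] (g : ι → N →ₗ[R] P) (f : M →ₗ[R] N) (s : Finset ι) :
    (∑ i ∈ s, g i).comp f = ∑ i ∈ s, (g i).comp f := by
  ext
  simp

section Antidiagonal

variable {N : Type*} [AddCommMonoid N]

theorem sum_antidiagonal_comm (F : ℕ → ℕ → N) (n : ℕ) :
    ∑ x ∈ antidiagonal n, F x.1 x.2 = ∑ x ∈ antidiagonal n, F x.2 x.1 :=
  (Finset.Nat.sum_antidiagonal_swap (f := fun x => F x.1 x.2)).symm

theorem sum_antidiagonal_assoc (F : ℕ → ℕ → ℕ → N) (n : ℕ) :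
    ∑ x ∈ antidiagonal n, ∑ y ∈ antidiagonal x.1, F y.1 y.2 x.2
      = ∑ x ∈ antidiagonal n, ∑ y ∈ antidiagonal x.2, F x.1 y.1 y.2 := by
  rw [Finset.sum_sigma', Finset.sum_sigma']
  refine Finset.sum_nbij' (fun z => ⟨(z.2.1, z.2.2 + z.1.2), (z.2.2, z.1.2)⟩)
    (fun z => ⟨(z.1.1 + z.2.1, z.2.2), (z.1.1, z.2.1)⟩) ?_ ?_ ?_ ?_ ?_ <;>
  · rintro ⟨⟨a, b⟩, c, d⟩
    simp only [Finset.mem_sigma, HasAntidiagonal.mem_antidiagonal, Sigma.mk.injEq, Prod.mk.injEq]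
    grind

theorem sum_antidiagonal_left_comm (F : ℕ → ℕ → ℕ → N) (n : ℕ) :
    ∑ x ∈ antidiagonal n, ∑ y ∈ antidiagonal x.2, F x.1 y.1 y.2
      = ∑ x ∈ antidiagonal n, ∑ y ∈ antidiagonal x.2, F y.1 x.1 y.2 := by
  rw [← sum_antidiagonal_assoc, ← sum_antidiagonal_assoc (fun a b c => F b a c)]
  exact Finset.sum_congr rfl fun x _ => sum_antidiagonal_comm (fun a b => F a b x.2) x.1

theorem sum_antidiagonal_right_comm (F : ℕ → ℕ → ℕ → N) (n : ℕ) :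
    ∑ x ∈ antidiagonal n, ∑ y ∈ antidiagonal x.1, F y.1 y.2 x.2
      = ∑ x ∈ antidiagonal n, ∑ y ∈ antidiagonal x.1, F y.1 x.2 y.2 := by
  rw [sum_antidiagonal_assoc, sum_antidiagonal_assoc (fun a b c => F a c b)]
  exact Finset.sum_congr rfl fun x _ => sum_antidiagonal_comm (F x.1) x.2

theorem sum_antidiagonal_interchange (F : ℕ → ℕ → ℕ → ℕ → N) (n : ℕ) :
    ∑ x ∈ antidiagonal n, ∑ y ∈ antidiagonal x.1, ∑ z ∈ antidiagonal x.2, F y.1 y.2 z.1 z.2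
      = ∑ x ∈ antidiagonal n, ∑ y ∈ antidiagonal x.1, ∑ z ∈ antidiagonal x.2,
          F y.1 z.1 y.2 z.2 := by
  rw [sum_antidiagonal_assoc (fun a b c => ∑ z ∈ antidiagonal c, F a b z.1 z.2),
    sum_antidiagonal_assoc (fun a b c => ∑ z ∈ antidiagonal c, F a z.1 b z.2)]
  exact Finset.sum_congr rfl fun x _ => sum_antidiagonal_left_comm (F x.1) x.2

end Antidiagonal

theorem isTwDiff_iff {A : Bigraded R} (d : WMap A A 0 1) :
    IsTwDiff A d ↔ ∀ m : ℕ, ∑ x ∈ antidiagonal m,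
      (-1 : ℤ) ^ x.1 • (tot (d x.1)).comp (tot (d x.2)) = 0 := by
  refine forall_congr' fun m => ?_
  rw [← tot_injective.eq_iff, map_zero, map_sum, ← Finset.sum_attach (antidiagonal m)]
  simp only [map_zsmul, tot_grecast, tot_gcomp]

theorem isTwMor_iff {A B : Bigraded R} (dA : WMap A A 0 1) (dB : WMap B B 0 1)
    (f : WMap A B 0 0) :
    IsTwMor dA dB f ↔ ∀ m : ℕ,
      ∑ x ∈ antidiagonal m, (tot (dB x.1)).comp (tot (f x.2))
        = ∑ x ∈ antidiagonal m, (-1 : ℤ) ^ x.1 • (tot (f x.1)).comp (tot (dA x.2)) := by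
  refine forall_congr' fun m => ?_
  rw [← tot_injective.eq_iff, map_sum, map_sum, ← Finset.sum_attach (antidiagonal m),
    ← Finset.sum_attach (antidiagonal m)]
  simp only [map_zsmul, tot_grecast, tot_gcomp]

theorem tot_tensorD {A B : Bigraded R} (dA : WMap A A 0 1) (dB : WMap B B 0 1) (m : ℕ) :
    tot (tensorD dA dB m) = totTensor (dA m) (idG B) + totTensor (idG A) (dB m) := by
  simp only [tensorD, map_add, tot_grecast, tot_gtensor]

theorem tot_tensorFamW {A A' B B' : Bigraded R} (f : WMap A A' 0 0) (g : WMap B B' 0 0) (m : ℕ) :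
    tot (tensorFamW f g m) = ∑ x ∈ antidiagonal m, totTensor (f x.1) (g x.2) := by
  rw [tensorFamW, map_sum, ← Finset.sum_attach (antidiagonal m)]
  simp only [tot_grecast, tot_gtensor]

theorem tot_compFam {A B C : Bigraded R} (g : WMap B C 0 0) (f : WMap A B 0 0) (m : ℕ) :
    tot (compFam g f m) = ∑ x ∈ antidiagonal m, (tot (g x.1)).comp (tot (f x.2)) := by
  rw [compFam, map_sum, ← Finset.sum_attach (antidiagonal m)]
  simp only [tot_grecast, tot_gcomp]

section Relations

variable {A A' B B' : Bigraded R} {p q : ℤ}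

theorem IsTwDiff.sum_totTensor_left {d : WMap A A 0 1} (hd : IsTwDiff A d)
    (g : GMap B B' p q) (m : ℕ) :
    ∑ x ∈ antidiagonal m, (-1 : ℤ) ^ x.1 • totTensor (gcomp (d x.1) (d x.2)) g = 0 := by
  have h := congrArg (fun F => totTensor F g) (hd m)
  rw [← Finset.sum_attach]
  simpa only [map_sum, map_zsmul, map_zero, LinearMap.sum_apply, LinearMap.smul_apply,
    LinearMap.zero_apply, totTensor_grecast_left] using h

theorem IsTwDiff.sum_totTensor_right {d : WMap B B 0 1} (hd : IsTwDiff B d)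
    (f : GMap A A' p q) (m : ℕ) :
    ∑ x ∈ antidiagonal m, (-1 : ℤ) ^ x.1 • totTensor f (gcomp (d x.1) (d x.2)) = 0 := by
  have h := congrArg (totTensor f) (hd m)
  rw [← Finset.sum_attach]
  simpa only [map_sum, map_zsmul, map_zero, totTensor_grecast_right] using h

theorem IsTwMor.sum_totTensor_left {dA : WMap A A 0 1} {dA' : WMap A' A' 0 1}
    {f : WMap A A' 0 0} (hf : IsTwMor dA dA' f) (g : GMap B B' p q) (m : ℕ) :
    ∑ x ∈ antidiagonal m, totTensor (gcomp (dA' x.1) (f x.2)) g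
      = ∑ x ∈ antidiagonal m, (-1 : ℤ) ^ x.1 • totTensor (gcomp (f x.1) (dA x.2)) g := by
  have h := congrArg (fun F => totTensor F g) (hf m)
  rw [← Finset.sum_attach (antidiagonal m), ← Finset.sum_attach (antidiagonal m)]
  simpa only [map_sum, map_zsmul, LinearMap.sum_apply, LinearMap.smul_apply,
    totTensor_grecast_left] using h

theorem IsTwMor.sum_totTensor_right {dB : WMap B B 0 1} {dB' : WMap B' B' 0 1}
    {g : WMap B B' 0 0} (hg : IsTwMor dB dB' g) (f : GMap A A' p q) (m : ℕ) :
    ∑ x ∈ antidiagonal m, totTensor f (gcomp (dB' x.1) (g x.2))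
      = ∑ x ∈ antidiagonal m, (-1 : ℤ) ^ x.1 • totTensor f (gcomp (g x.1) (dB x.2)) := by
  have h := congrArg (totTensor f) (hg m)
  rw [← Finset.sum_attach (antidiagonal m), ← Finset.sum_attach (antidiagonal m)]
  simpa only [map_sum, map_zsmul, totTensor_grecast_right] using h

theorem totTensor_compFam_left {A'' : Bigraded R} (f : WMap A' A'' 0 0) (f' : WMap A A' 0 0)
    (g : GMap B B' p q) (m : ℕ) :
    totTensor (compFam f f' m) g
      = ∑ x ∈ antidiagonal m, totTensor (gcomp (f x.1) (f' x.2)) g := by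
  rw [← Finset.sum_attach (antidiagonal m)]
  simp only [compFam, map_sum, LinearMap.sum_apply, totTensor_grecast_left]

theorem totTensor_compFam_right {B'' : Bigraded R} (f : GMap A A' p q)
    (g : WMap B' B'' 0 0) (g' : WMap B B' 0 0) (m : ℕ) :
    totTensor f (compFam g g' m)
      = ∑ x ∈ antidiagonal m, totTensor f (gcomp (g x.1) (g' x.2)) := by
  rw [← Finset.sum_attach (antidiagonal m)]
  simp only [compFam, map_sum, totTensor_grecast_right]

end Relations

theorem negOnePow_eq_neg_one_pow {a : ℤ} {n : ℕ} (h : Even (a - n)) :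
    (Int.negOnePow a : ℤ) = (-1) ^ n := by
  rw [(Int.negOnePow_eq_iff a n).mpr h, Int.negOnePow_def, zpow_natCast, Units.val_pow_eq_pow_val,
    Units.val_neg, Units.val_one]

theorem isTwDiff_tensorD {A B : Bigraded R} {dA : WMap A A 0 1} {dB : WMap B B 0 1}
    (hA : IsTwDiff A dA) (hB : IsTwDiff B dB) : IsTwDiff (tensorBG A B) (tensorD dA dB) := by
  rw [isTwDiff_iff]
  intro m
  have sign (i j : ℕ) : (Int.negOnePow ((0 - (i : ℤ)) * (0 - (j : ℤ)) +
      (1 - (i : ℤ)) * (1 - (j : ℤ))) : ℤ) = (-1) ^ (i + j + 1) :=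
    negOnePow_eq_neg_one_pow ⟨i * j - i - j, by push_cast; ring⟩
  have sign_id (i : ℕ) : (Int.negOnePow ((0 - (i : ℤ)) * 0 + (1 - (i : ℤ)) * 0) : ℤ) = 1 := by
    simp
  simp only [tot_tensorD, LinearMap.add_comp, LinearMap.comp_add, smul_add, Finset.sum_add_distrib,
    totTensor_comp_idG_right, totTensor_idG_left_comp, sign, sign_id, one_smul,
    hA.sum_totTensor_left, hB.sum_totTensor_right, gcomp_idG, totTensor_grecast_left,
    totTensor_grecast_right, zero_add, add_zero, smul_smul]
  rw [sum_antidiagonal_comm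
    (fun i j => ((-1 : ℤ) ^ i * (-1) ^ (i + j + 1)) • totTensor (dA j) (dB i)),
    ← Finset.sum_add_distrib]
  refine Finset.sum_eq_zero fun x _ => ?_
  rw [← add_smul]
  convert zero_smul ℤ _
  rw [← pow_add, show x.2 + (x.2 + x.1 + 1) = 2 * x.2 + (x.1 + 1) by ring, pow_add, pow_mul]
  ring

theorem isTwMor_tensorFamW {A A' B B' : Bigraded R} {dA : WMap A A 0 1} {dA' : WMap A' A' 0 1}
    {dB : WMap B B 0 1} {dB' : WMap B' B' 0 1} {f : WMap A A' 0 0} {g : WMap B B' 0 0}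
    (hf : IsTwMor dA dA' f) (hg : IsTwMor dB dB' g) :
    IsTwMor (tensorD dA dB) (tensorD dA' dB') (tensorFamW f g) := by
  rw [isTwMor_iff]
  intro m
  have sign_left (i j : ℕ) : (Int.negOnePow ((0 - (i : ℤ)) * (0 - (j : ℤ)) +
      (1 - (i : ℤ)) * (0 - (j : ℤ))) : ℤ) = (-1) ^ j :=
    negOnePow_eq_neg_one_pow ⟨i * j - j, by ring⟩
  have sign_right (i j : ℕ) : (Int.negOnePow ((0 - (i : ℤ)) * (0 - (j : ℤ)) +
      (0 - (i : ℤ)) * (1 - (j : ℤ))) : ℤ) = (-1) ^ i :=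
    negOnePow_eq_neg_one_pow ⟨i * j - i, by ring⟩
  simp only [tot_tensorD, tot_tensorFamW, LinearMap.add_comp, LinearMap.comp_add,
    linearMap_comp_sum, linearMap_sum_comp, smul_add, Finset.smul_sum, Finset.sum_add_distrib,
    totTensor_comp_idG_right, totTensor_idG_left_comp, totTensor_comp_totTensor_idG_right,
    totTensor_comp_totTensor_idG_left, sign_left, sign_right, smul_smul]
  have signed_pow (x : ℕ × ℕ) (y : ℕ × ℕ) (hy : y ∈ antidiagonal x.1) :
      (-1 : ℤ) ^ x.1 = (-1) ^ y.1 * (-1) ^ y.2 := by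
    rw [← pow_add, HasAntidiagonal.mem_antidiagonal.mp hy]
  congr 1
  · rw [← sum_antidiagonal_assoc (fun i j k => totTensor (gcomp (dA' i) (f j)) (g k))]
    simp only [hf.sum_totTensor_left]
    rw [sum_antidiagonal_right_comm
      (fun j i k => (-1 : ℤ) ^ j • totTensor (gcomp (f j) (dA i)) (g k))]
    refine Finset.sum_congr rfl fun x _ => Finset.sum_congr rfl fun y hy => ?_
    rw [signed_pow x y hy, mul_assoc, ← mul_pow]
    simp
  · rw [sum_antidiagonal_left_comm
      (fun i j k => (-1 : ℤ) ^ j • totTensor (f j) (gcomp (dB' i) (g k)))]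
    simp only [← Finset.smul_sum, hg.sum_totTensor_right]
    simp only [Finset.smul_sum, smul_smul]
    rw [← sum_antidiagonal_assoc
      (fun j k i => ((-1 : ℤ) ^ j * (-1) ^ k) • totTensor (f j) (gcomp (g k) (dB i)))]
    refine Finset.sum_congr rfl fun x _ => Finset.sum_congr rfl fun y hy => ?_
    rw [signed_pow x y hy]

theorem compFam_tensorFamW {A A' A'' B B' B'' : Bigraded R} (f : WMap A' A'' 0 0)
    (g : WMap B' B'' 0 0) (f' : WMap A A' 0 0) (g' : WMap B B' 0 0) :
    compFam (tensorFamW f g) (tensorFamW f' g') = tensorFamW (compFam f f') (compFam g g') := by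
  funext m
  apply tot_injective
  have sign (i j : ℕ) : (Int.negOnePow ((0 - (i : ℤ)) * (0 - (j : ℤ)) +
      (0 - (i : ℤ)) * (0 - (j : ℤ))) : ℤ) = 1 := by
    simpa using negOnePow_eq_neg_one_pow (n := 0) ⟨(0 - (i : ℤ)) * (0 - (j : ℤ)), by simp⟩
  simp only [tot_compFam, tot_tensorFamW, totTensor_compFam_left, totTensor_compFam_right,
    linearMap_comp_sum, linearMap_sum_comp, totTensor_comp, sign, one_smul]
  refine (Finset.sum_congr rfl fun x _ => Finset.sum_comm).trans <|
    (sum_antidiagonal_interchange (fun i k j l =>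
      totTensor (gcomp (f i) (f' j)) (gcomp (g k) (g' l))) m).trans <|
    Finset.sum_congr rfl fun x _ => Finset.sum_comm

/-- For twisted complexes `(A, d^A)`, `(B, d^B)`, the bigraded module `A ⊗ B`
with the maps `∂_m = d^A_m ⊗ 1 + 1 ⊗ d^B_m` is a twisted complex; for morphisms `f' : A → A'`,
`f : A' → A''`, `g' : B → B'`, `g : B' → B''` of twisted complexes the family
`(f' ⊗ g')_m = ∑_{i+j=m} f'_i ⊗ g'_j` is a morphism of twisted complexes `A ⊗ B → A' ⊗ B'`, and
the assignment is functorial: `(f ⊗ g) ∘ (f' ⊗ g') = (f ∘ f') ⊗ (g ∘ g')`. -/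
theorem tensor_of_twisted_complexes {R : Type} [CommRing R]
    (A A' A'' B B' B'' : TwComplex R)
    (f' : TwMorphism A A') (f : TwMorphism A' A'')
    (g' : TwMorphism B B') (g : TwMorphism B' B'') :
    IsTwDiff (tensorBG A.toBigraded B.toBigraded) (tensorD A.d B.d) ∧
    IsTwMor (tensorD A.d B.d) (tensorD A'.d B'.d) (tensorFamW f'.f g'.f) ∧
    compFam (tensorFamW f.f g.f) (tensorFamW f'.f g'.f)
      = tensorFamW (compFam f.f f'.f) (compFam g.f g'.f) := by
  exact ⟨isTwDiff_tensorD A.isTw B.isTw, isTwMor_tensorFamW f'.isMor g'.isMor,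
    compFam_tensorFamW f.f g.f f'.f g'.f⟩
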